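/- Let S be a measurable space, let ν be a probability measure on S, let β, γ ∈ ℝ\{0} with β < γ, and let g : S → ℝ be bounded and measurable. Then the supremum over probability measures θ of [ (1/β) log ∫_S e^{βg} dθ − (1/(γ−β)) R_{γ/(γ−β)}(θ‖ν) ] is attained at the probability measure θ* defined by dθ* = e^{(γ−β)g} dν / Z with Z = ∫_S e^{(γ−β)g} dν, and θ* is the unique maximizer. -/

import Mathlib

open MeasureTheory Real ProbabilityTheory
open scoped Classical

/-- Rényi divergence of order `α > 0`, `α ≠ 1`, of `ν` from `θ`, defined using densities with
respect to the dominating measure `ν + θ`. -/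
noncomputable def renyiDivAux {S : Type*} [MeasurableSpace S] (α : ℝ)
    (ν θ : Measure S) : EReal :=
  if 1 < α ∧ ¬ ν ≪ θ then ⊤
  else ((α * (α - 1))⁻¹ : ℝ) *
    ENNReal.log (∫⁻ x in {x | 0 < ν.rnDeriv (ν + θ) x ∧ 0 < θ.rnDeriv (ν + θ) x},
      (ν.rnDeriv (ν + θ) x / θ.rnDeriv (ν + θ) x) ^ α ∂θ)

/-- Rényi divergence of order `α ∈ ℝ \ {0, 1}`, extended to negative orders by
`R_α(ν‖θ) = R_{1-α}(θ‖ν)`. -/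
noncomputable def renyiDiv {S : Type*} [MeasurableSpace S] (α : ℝ)
    (ν θ : Measure S) : EReal :=
  if α < 0 then renyiDivAux (1 - α) θ ν else renyiDivAux α ν θ

/-- The integral in the Rényi divergence of positive order, in terms of the Radon–Nikodym
derivative of one measure with respect to the other. -/
lemma setLIntegral_rnDeriv_div_rpow {S : Type*} [MeasurableSpace S] {α : ℝ} (hα : 0 < α)
    (θ ν : Measure S) [IsFiniteMeasure θ] [IsFiniteMeasure ν] :
    ∫⁻ x in {x | 0 < θ.rnDeriv (θ + ν) x ∧ 0 < ν.rnDeriv (θ + ν) x},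
      (θ.rnDeriv (θ + ν) x / ν.rnDeriv (θ + ν) x) ^ α ∂ν = ∫⁻ x, θ.rnDeriv ν x ^ α ∂ν := by
  have hac : ν ≪ θ + ν := Measure.AbsolutelyContinuous.rfl.add_right' _
  have hD : MeasurableSet {x | 0 < θ.rnDeriv (θ + ν) x ∧ 0 < ν.rnDeriv (θ + ν) x} :=
    (measurableSet_lt measurable_const (Measure.measurable_rnDeriv _ _)).inter
      (measurableSet_lt measurable_const (Measure.measurable_rnDeriv _ _))
  rw [← lintegral_indicator hD]
  refine lintegral_congr_ae ?_
  filter_upwards [θ.rnDeriv_eq_div_rnDeriv_add ν, Measure.rnDeriv_pos hac] with x hx hpos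
  by_cases h : 0 < θ.rnDeriv (θ + ν) x
  · rw [hx]
    refine Set.indicator_of_mem ?_ _
    exact ⟨h, hpos⟩
  · rw [Set.indicator_of_notMem (fun hm => h hm.1), hx, nonpos_iff_eq_zero.mp (not_lt.mp h)]
    simp [hα]

lemma lintegral_rnDeriv_rpow_one_sub {S : Type*} [MeasurableSpace S] {α : ℝ} (hα : α < 0)
    {θ ν : Measure S} [IsFiniteMeasure θ] [IsFiniteMeasure ν] (h : ν ≪ θ) :
    ∫⁻ x, ν.rnDeriv θ x ^ (1 - α) ∂θ = ∫⁻ x, θ.rnDeriv ν x ^ α ∂ν := by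
  calc ∫⁻ x, ν.rnDeriv θ x ^ (1 - α) ∂θ
      = ∫⁻ x, ν.rnDeriv θ x * ν.rnDeriv θ x ^ (-α) ∂θ := by
        refine lintegral_congr fun x => ?_
        rw [sub_eq_add_neg, ENNReal.rpow_add_of_nonneg _ _ zero_le_one (by linarith),
          ENNReal.rpow_one]
    _ = ∫⁻ x, ν.rnDeriv θ x ^ (-α) ∂ν :=
        lintegral_rnDeriv_mul h ((Measure.measurable_rnDeriv _ _).pow_const _).aemeasurable
    _ = ∫⁻ x, θ.rnDeriv ν x ^ α ∂ν := by
        refine lintegral_congr_ae ?_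
        filter_upwards [Measure.inv_rnDeriv h] with x hx
        rw [← hx, Pi.inv_apply, ENNReal.inv_rpow, ENNReal.rpow_neg]

lemma renyiDiv_eq_ite {S : Type*} [MeasurableSpace S] {α : ℝ} (hα : α ≠ 0)
    (θ ν : Measure S) [IsFiniteMeasure θ] [IsFiniteMeasure ν] :
    renyiDiv α θ ν = if (1 < α ∧ ¬ θ ≪ ν) ∨ (α < 0 ∧ ¬ ν ≪ θ) then ⊤
      else ((α * (α - 1))⁻¹ : ℝ) * ENNReal.log (∫⁻ x, θ.rnDeriv ν x ^ α ∂ν) := by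
  rcases lt_or_gt_of_ne hα with h | h
  · have h1 : ¬ 1 < α := by linarith
    have h2 : 1 < 1 - α := by linarith
    by_cases hac : ν ≪ θ
    · simp only [renyiDiv, renyiDivAux, h, h1, h2, hac, if_true, not_true_eq_false, and_false,
        if_false, false_and, or_self]
      rw [setLIntegral_rnDeriv_div_rpow (by linarith), lintegral_rnDeriv_rpow_one_sub h hac]
      congr 3
      ring
    · simp [renyiDiv, renyiDivAux, h, hac]
  · have h1 : ¬ α < 0 := by linarith
    simp only [renyiDiv, renyiDivAux, h1, if_false, false_and, or_false]
    rw [setLIntegral_rnDeriv_div_rpow h]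

/-- Strict Bernoulli inequality for all real exponents other than `0` and `1`. -/
lemma mul_rpow_sub_tangent_pos {α u : ℝ} (h0 : α ≠ 0) (h1 : α ≠ 1) (hu : 0 ≤ u)
    (hu' : α < 0 → 0 < u) (hne : u ≠ 1) :
    0 < (α * (α - 1)) * (u ^ α - 1 - α * (u - 1)) := by
  have hs : u - 1 ≠ 0 := sub_ne_zero.mpr hne
  rcases lt_or_gt_of_ne h0 with h | h
  · have hu0 := hu' h
    have hb := one_add_mul_self_lt_rpow_one_add (s := u⁻¹ - 1)
      (by have := inv_pos.mpr hu0; linarith)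
      (sub_ne_zero.mpr (by simpa using hne)) (p := 1 - α) (by linarith)
    rw [add_sub_cancel, Real.inv_rpow hu, ← Real.rpow_neg hu, neg_sub] at hb
    have hmul := mul_lt_mul_of_pos_right hb hu0
    rw [← Real.rpow_add_one hu0.ne', sub_add_cancel] at hmul
    have : (1 + (1 - α) * (u⁻¹ - 1)) * u = 1 + α * (u - 1) := by
      field_simp
      ring
    exact mul_pos (mul_pos_of_neg_of_neg h (by linarith)) (by linarith)
  · rcases lt_or_gt_of_ne h1 with h' | h'
    · have hb := rpow_one_add_lt_one_add_mul_self (s := u - 1) (by linarith) hs h h'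
      rw [add_sub_cancel] at hb
      exact mul_pos_of_neg_of_neg (mul_neg_of_pos_of_neg h (by linarith)) (by linarith)
    · have hb := one_add_mul_self_lt_rpow_one_add (s := u - 1) (by linarith) hs h'
      rw [add_sub_cancel] at hb
      exact mul_pos (mul_pos h (by linarith)) (by linarith)

lemma mul_rpow_sub_tangent_nonneg {α u : ℝ} (h0 : α ≠ 0) (h1 : α ≠ 1) (hu : 0 ≤ u)
    (hu' : α < 0 → 0 < u) :
    0 ≤ (α * (α - 1)) * (u ^ α - 1 - α * (u - 1)) := by
  by_cases hne : u = 1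
  · simp [hne]
  · exact (mul_rpow_sub_tangent_pos h0 h1 hu hu' hne).le

/-- Weighted Jensen inequality for powers, with its equality case. -/
lemma jensen_rpow {S : Type*} [MeasurableSpace S] {ν : Measure S} {α : ℝ}
    (h0 : α ≠ 0) (h1 : α ≠ 1) {w h : S → ℝ} (hw : ∀ x, 0 < w x)
    (hh : ∀ᵐ x ∂ν, 0 ≤ h x) (hh' : α < 0 → ∀ᵐ x ∂ν, 0 < h x)
    (hwi : Integrable w ν) (hwh : Integrable (fun x => w x * h x) ν)
    (hwp : Integrable (fun x => w x * h x ^ α) ν)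
    (hW : 0 < ∫ x, w x ∂ν) (hM : 0 < ∫ x, w x * h x ∂ν) :
    let c := (∫ x, w x * h x ∂ν) / ∫ x, w x ∂ν
    0 ≤ (α * (α - 1)) * ((∫ x, w x * h x ^ α ∂ν) - c ^ α * ∫ x, w x ∂ν) ∧
      ((∫ x, w x * h x ^ α ∂ν) = c ^ α * ∫ x, w x ∂ν → ∀ᵐ x ∂ν, h x = c) := by
  intro c
  have hc : 0 < c := div_pos hM hW
  have hcα : 0 < c ^ α := Real.rpow_pos_of_pos hc α
  let φ : S → ℝ := fun x => w x * ((α * (α - 1)) * ((h x / c) ^ α - 1 - α * (h x / c - 1)))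
  have hu' : ∀ᵐ x ∂ν, α < 0 → 0 < h x / c := by
    by_cases hα : α < 0
    · filter_upwards [hh' hα] with x hx _ using div_pos hx hc
    · exact Filter.Eventually.of_forall fun x hx => absurd hx hα
  have hφ0 : 0 ≤ᵐ[ν] φ := by
    filter_upwards [hh, hu'] with x hx hx'
    exact mul_nonneg (hw x).le (mul_rpow_sub_tangent_nonneg h0 h1 (div_nonneg hx hc.le) hx')
  have hφ : φ =ᵐ[ν] fun x => (α * (α - 1)) * ((c ^ α)⁻¹ * (w x * h x ^ α) - w x
      - α * (c⁻¹ * (w x * h x) - w x)) := by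
    filter_upwards [hh] with x hx
    simp only [φ]
    rw [Real.div_rpow hx hc.le]
    ring
  have hi1 : Integrable (fun x => (c ^ α)⁻¹ * (w x * h x ^ α)) ν := hwp.const_mul _
  have hi2 : Integrable (fun x => c⁻¹ * (w x * h x)) ν := hwh.const_mul _
  have hi3 : Integrable (fun x => (c ^ α)⁻¹ * (w x * h x ^ α) - w x) ν := hi1.sub hwi
  have hi4 : Integrable (fun x => α * (c⁻¹ * (w x * h x) - w x)) ν := (hi2.sub hwi).const_mul α
  have hφi : Integrable φ ν := ((hi3.sub hi4).const_mul _).congr hφ.symm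
  have hval : ∫ x, φ x ∂ν = (α * (α - 1)) *
      ((∫ x, w x * h x ^ α ∂ν) - c ^ α * ∫ x, w x ∂ν) * (c ^ α)⁻¹ := by
    rw [integral_congr_ae hφ, integral_const_mul,
      integral_sub hi3 hi4, integral_sub hi1 hwi,
      integral_const_mul, integral_const_mul, integral_sub hi2 hwi, integral_const_mul]
    have : c⁻¹ * ∫ x, w x * h x ∂ν = ∫ x, w x ∂ν := by
      simp only [c]
      field_simp
    rw [this]
    field_simp
    ring
  refine ⟨?_, fun heq => ?_⟩
  · have := integral_nonneg_of_ae hφ0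
    rw [hval] at this
    exact nonneg_of_mul_nonneg_left this (inv_pos.mpr hcα)
  · have hz : ∫ x, φ x ∂ν = 0 := by rw [hval, heq]; simp
    filter_upwards [(integral_eq_zero_iff_of_nonneg_ae hφ0 hφi).mp hz, hh, hu'] with x hx hx1 hx2
    by_contra hne
    refine (mul_pos (hw x) (mul_rpow_sub_tangent_pos h0 h1 (div_nonneg hx1 hc.le) hx2 ?_)).ne' hx
    rwa [ne_eq, div_eq_one_iff_eq hc.ne']

lemma jensen_rpow_log {S : Type*} [MeasurableSpace S] {ν : Measure S} {α : ℝ}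
    (h0 : α ≠ 0) (h1 : α ≠ 1) {w h : S → ℝ} (hw : ∀ x, 0 < w x)
    (hh : ∀ᵐ x ∂ν, 0 ≤ h x) (hh' : α < 0 → ∀ᵐ x ∂ν, 0 < h x)
    (hwi : Integrable w ν) (hwh : Integrable (fun x => w x * h x) ν)
    (hwp : Integrable (fun x => w x * h x ^ α) ν)
    (hW : 0 < ∫ x, w x ∂ν) (hM : 0 < ∫ x, w x * h x ∂ν) (hB : 0 < ∫ x, w x * h x ^ α ∂ν) :
    let L := Real.log (∫ x, w x * h x ^ α ∂ν) - α * Real.log (∫ x, w x * h x ∂ν)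
      + (α - 1) * Real.log (∫ x, w x ∂ν)
    0 ≤ (α * (α - 1))⁻¹ * L ∧
      (L = 0 → ∀ᵐ x ∂ν, h x = (∫ x, w x * h x ∂ν) / ∫ x, w x ∂ν) := by
  intro L
  obtain ⟨hle, heq⟩ := jensen_rpow h0 h1 hw hh hh' hwi hwh hwp hW hM
  set W := ∫ x, w x ∂ν
  set M := ∫ x, w x * h x ∂ν
  set B := ∫ x, w x * h x ^ α ∂ν
  have hc : 0 < (M / W) ^ α := Real.rpow_pos_of_pos (div_pos hM hW) α
  have hL : L = Real.log B - Real.log ((M / W) ^ α * W) := by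
    rw [Real.log_mul hc.ne' hW.ne', Real.log_rpow (div_pos hM hW), Real.log_div hM.ne' hW.ne']
    simp only [L]
    ring
  have hcW : 0 < (M / W) ^ α * W := mul_pos hc hW
  have hα1 : α - 1 ≠ 0 := sub_ne_zero.mpr h1
  refine ⟨?_, fun hz => heq ?_⟩
  · rw [hL]
    rcases lt_or_gt_of_ne (mul_ne_zero h0 hα1) with hs | hs
    · have : B ≤ (M / W) ^ α * W := by
        by_contra! hlt
        exact (mul_neg_of_neg_of_pos hs (sub_pos.mpr hlt)).not_ge hle
      exact mul_nonneg_of_nonpos_of_nonpos (inv_nonpos.mpr hs.le)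
        (sub_nonpos.mpr (Real.log_le_log hB this))
    · have : (M / W) ^ α * W ≤ B := by
        by_contra! hlt
        exact (mul_neg_of_pos_of_neg hs (sub_neg.mpr hlt)).not_ge hle
      exact mul_nonneg (inv_nonneg.mpr hs.le) (sub_nonneg.mpr (Real.log_le_log hcW this))
  · rw [hL, sub_eq_zero] at hz
    exact Real.log_injOn_pos hB hcW hz

lemma ae_rnDeriv_rpow_eq_ofReal {S : Type*} [MeasurableSpace S] {α : ℝ} (h0 : α ≠ 0)
    {θ ν : Measure S} [IsFiniteMeasure θ] [IsFiniteMeasure ν] (hν : α < 0 → ν ≪ θ) :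
    ∀ᵐ x ∂ν, θ.rnDeriv ν x ^ α = ENNReal.ofReal ((θ.rnDeriv ν x).toReal ^ α) := by
  rcases lt_or_gt_of_ne h0 with h | h
  · filter_upwards [θ.rnDeriv_lt_top ν, Measure.rnDeriv_pos' (hν h)] with x hx hx'
    rw [← ENNReal.ofReal_rpow_of_pos (ENNReal.toReal_pos hx'.ne' hx.ne),
      ENNReal.ofReal_toReal hx.ne]
  · filter_upwards [θ.rnDeriv_lt_top ν] with x hx
    rw [← ENNReal.ofReal_rpow_of_nonneg ENNReal.toReal_nonneg h.le, ENNReal.ofReal_toReal hx.ne]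

lemma ae_toReal_rnDeriv_pos {S : Type*} [MeasurableSpace S]
    {θ ν : Measure S} [IsFiniteMeasure θ] [IsFiniteMeasure ν] (h : ν ≪ θ) :
    ∀ᵐ x ∂ν, 0 < (θ.rnDeriv ν x).toReal := by
  filter_upwards [θ.rnDeriv_lt_top ν, Measure.rnDeriv_pos' h] with x hx hx'
  exact ENNReal.toReal_pos hx'.ne' hx.ne

/-- A Rényi divergence of probability measures is either infinite, or given by the logarithm
of a convergent and positive integral. -/
lemma renyiDiv_eq_top_or {S : Type*} [MeasurableSpace S] {α : ℝ} (h0 : α ≠ 0) (h1 : α ≠ 1)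
    (θ ν : Measure S) [IsProbabilityMeasure θ] [IsProbabilityMeasure ν] :
    renyiDiv α θ ν = ⊤ ∨
      ((1 < α → θ ≪ ν) ∧ (α < 0 → ν ≪ θ) ∧
        Integrable (fun x => (θ.rnDeriv ν x).toReal ^ α) ν ∧
        (¬ ∀ᵐ x ∂ν, (θ.rnDeriv ν x).toReal = 0) ∧
        0 < ∫ x, (θ.rnDeriv ν x).toReal ^ α ∂ν ∧
        renyiDiv α θ ν =
          (((α * (α - 1))⁻¹ * Real.log (∫ x, (θ.rnDeriv ν x).toReal ^ α ∂ν) : ℝ) : EReal)) := by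
  rw [renyiDiv_eq_ite h0]
  by_cases hbad : (1 < α ∧ ¬ θ ≪ ν) ∨ (α < 0 ∧ ¬ ν ≪ θ)
  · exact Or.inl (if_pos hbad)
  rw [if_neg hbad]
  push Not at hbad
  obtain ⟨hθν, hνθ⟩ := hbad
  have hfα : 0 ≤ᵐ[ν] fun x => (θ.rnDeriv ν x).toReal ^ α :=
    Filter.Eventually.of_forall fun x => Real.rpow_nonneg ENNReal.toReal_nonneg α
  have hmeas : AEStronglyMeasurable (fun x => (θ.rnDeriv ν x).toReal ^ α) ν :=
    ((Measure.measurable_rnDeriv θ ν).ennreal_toReal.pow_const α).aestronglyMeasurable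
  rw [lintegral_congr_ae (ae_rnDeriv_rpow_eq_ofReal h0 hνθ)]
  by_cases hint : Integrable (fun x => (θ.rnDeriv ν x).toReal ^ α) ν
  swap
  · left
    have hpos : 0 < α * (α - 1) := by
      by_contra! hle
      refine hint ?_
      have hα0 : 0 < α := by
        by_contra! hα
        have : α < 0 := lt_of_le_of_ne hα h0
        nlinarith
      refine Integrable.mono' (g := fun x => 1 + α * ((θ.rnDeriv ν x).toReal - 1))
        ((integrable_const _).add ((Measure.integrable_toReal_rnDeriv.sub
          (integrable_const _)).const_mul α)) hmeas ?_
      filter_upwards [] with x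
      rw [Real.norm_of_nonneg (Real.rpow_nonneg ENNReal.toReal_nonneg α)]
      have hb := mul_rpow_sub_tangent_nonneg h0 h1 (u := (θ.rnDeriv ν x).toReal)
        ENNReal.toReal_nonneg (fun h => absurd hα0 (by linarith))
      have hlt : α * (α - 1) < 0 :=
        lt_of_le_of_ne hle (mul_ne_zero h0 (sub_ne_zero.mpr h1))
      nlinarith
    have htop : ∫⁻ x, ENNReal.ofReal ((θ.rnDeriv ν x).toReal ^ α) ∂ν = ⊤ := by
      by_contra hne
      exact hint ((lintegral_ofReal_ne_top_iff_integrable hmeas hfα).mp hne)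
    rw [htop, ENNReal.log_top]
    exact EReal.coe_mul_top_of_pos (inv_pos.mpr hpos)
  rw [← ofReal_integral_eq_lintegral_ofReal hint hfα]
  have hzero : (∀ᵐ x ∂ν, (θ.rnDeriv ν x).toReal = 0) → 0 < α ∧ α < 1 := by
    intro hz
    constructor
    · by_contra! hα
      have hα : α < 0 := lt_of_le_of_ne hα h0
      obtain ⟨x, hx, hx'⟩ := (hz.and (ae_toReal_rnDeriv_pos (hνθ hα))).exists
      exact hx'.ne' hx
    · by_contra! hα
      have hac := hθν (lt_of_le_of_ne hα (Ne.symm h1))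
      have := Measure.integral_toReal_rnDeriv hac
      rw [integral_congr_ae hz] at this
      simp at this
  rcases (integral_nonneg_of_ae hfα).eq_or_lt with hI | hI
  · left
    have hz : ∀ᵐ x ∂ν, (θ.rnDeriv ν x).toReal = 0 := by
      filter_upwards [(integral_eq_zero_iff_of_nonneg_ae hfα hint).mp hI.symm] with x hx
      exact (Real.rpow_eq_zero ENNReal.toReal_nonneg h0).mp hx
    obtain ⟨hα0, hα1⟩ := hzero hz
    have hI' : ∫ x, (θ.rnDeriv ν x).toReal ^ α ∂ν = 0 := hI.symm
    rw [hI', ENNReal.ofReal_zero, ENNReal.log_zero]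
    exact EReal.coe_mul_bot_of_neg
      (inv_lt_zero.mpr (mul_neg_of_pos_of_neg hα0 (by linarith)))
  · right
    refine ⟨hθν, hνθ, hint, fun hz => hI.ne' ?_, hI, ?_⟩
    · rw [integral_eq_zero_of_ae]
      filter_upwards [hz] with x hx
      simp [hx, h0]
    · rw [ENNReal.log_ofReal_of_pos hI, EReal.coe_mul]

lemma integrable_exp_mul_of_bounded {S : Type*} [MeasurableSpace S] (μ : Measure S)
    [IsFiniteMeasure μ] {g : S → ℝ} (hg : Measurable g) {C : ℝ} (hC : ∀ x, |g x| ≤ C) (t : ℝ) :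
    Integrable (fun x => Real.exp (t * g x)) μ := by
  refine Integrable.of_bound (by fun_prop) (Real.exp (|t| * C))
    (Filter.Eventually.of_forall fun x => ?_)
  rw [Real.norm_of_nonneg (Real.exp_pos _).le]
  refine Real.exp_le_exp.mpr ((le_abs_self _).trans ?_)
  rw [abs_mul]
  exact mul_le_mul_of_nonneg_left (hC x) (abs_nonneg t)

/-- Splitting of an integral along the Lebesgue decomposition. -/
lemma integral_eq_integral_rnDeriv_add_singularPart {S : Type*} [MeasurableSpace S] (θ ν : Measure S)
    [IsFiniteMeasure θ] [IsFiniteMeasure ν] {φ : S → ℝ} (hφ : Integrable φ θ) :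
    Integrable (fun x => (θ.rnDeriv ν x).toReal * φ x) ν ∧
    ∫ x, φ x ∂θ = (∫ x, (θ.rnDeriv ν x).toReal * φ x ∂ν) + ∫ x, φ x ∂(θ.singularPart ν) := by
  have hm := Measure.measurable_rnDeriv θ ν
  have hdec := θ.haveLebesgueDecomposition_add ν
  have h1 : Integrable φ (ν.withDensity (θ.rnDeriv ν)) :=
    hφ.mono_measure (Measure.withDensity_rnDeriv_le θ ν)
  have h2 : Integrable φ (θ.singularPart ν) := hφ.mono_measure (Measure.singularPart_le θ ν)
  refine ⟨?_, ?_⟩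
  · exact (integrable_withDensity_iff_integrable_smul' hm (θ.rnDeriv_lt_top ν)).mp h1
  · conv_lhs => rw [hdec, integral_add_measure h2 h1, add_comm]
    rw [integral_withDensity_eq_integral_toReal_smul hm (θ.rnDeriv_lt_top ν)]
    rfl

/-- The upper bound in the Rényi variational formula, with its equality case, for measures at finite
divergence. -/
lemma renyi_functional_le {S : Type*} [MeasurableSpace S]
    (ν θ : Measure S) [IsProbabilityMeasure ν] [IsProbabilityMeasure θ]
    {β γ : ℝ} (hβ : β ≠ 0) (hγ : γ ≠ 0) (hβγ : β < γ)
    {g : S → ℝ} (hg : Measurable g) {C : ℝ} (hC : ∀ x, |g x| ≤ C)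
    (hθν : 1 < γ / (γ - β) → θ ≪ ν) (hνθ : γ / (γ - β) < 0 → ν ≪ θ)
    (hint : Integrable (fun x => (θ.rnDeriv ν x).toReal ^ (γ / (γ - β))) ν)
    (hne : ¬ ∀ᵐ x ∂ν, (θ.rnDeriv ν x).toReal = 0)
    (hB : 0 < ∫ x, (θ.rnDeriv ν x).toReal ^ (γ / (γ - β)) ∂ν) :
    let V := β⁻¹ * Real.log (∫ x, Real.exp (β * g x) ∂θ) - (γ - β)⁻¹ *
      ((γ / (γ - β) * (γ / (γ - β) - 1))⁻¹ *
        Real.log (∫ x, (θ.rnDeriv ν x).toReal ^ (γ / (γ - β)) ∂ν))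
    V ≤ γ⁻¹ * Real.log (∫ x, Real.exp (γ * g x) ∂ν) ∧
      (V = γ⁻¹ * Real.log (∫ x, Real.exp (γ * g x) ∂ν) → θ ≪ ν ∧
        ∃ c, ∀ᵐ x ∂ν, (θ.rnDeriv ν x).toReal = c * Real.exp ((γ - β) * g x)) := by
  intro V
  have hk : 0 < γ - β := sub_pos.mpr hβγ
  have hα0 : γ / (γ - β) ≠ 0 := div_ne_zero hγ hk.ne'
  have hα1 : γ / (γ - β) - 1 = β / (γ - β) := by field_simp; ring
  have hα1' : γ / (γ - β) ≠ 1 := sub_ne_zero.mp (hα1 ▸ div_ne_zero hβ hk.ne')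
  let f : S → ℝ := fun x => (θ.rnDeriv ν x).toReal
  let w : S → ℝ := fun x => Real.exp (γ * g x)
  let h : S → ℝ := fun x => f x * Real.exp (-((γ - β) * g x))
  have hwh : (fun x => w x * h x) = fun x => f x * Real.exp (β * g x) := by
    funext x
    simp only [w, h]
    rw [mul_left_comm, ← Real.exp_add]
    ring_nf
  have hwp : (fun x => w x * h x ^ (γ / (γ - β))) = fun x => f x ^ (γ / (γ - β)) := by
    funext x
    simp only [w, h]
    rw [Real.mul_rpow ENNReal.toReal_nonneg (Real.exp_pos _).le, ← Real.exp_mul, mul_left_comm,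
      ← Real.exp_add]
    have : γ * g x + -((γ - β) * g x) * (γ / (γ - β)) = 0 := by field_simp; ring
    rw [this, Real.exp_zero, mul_one]
  obtain ⟨hfi, hA⟩ := integral_eq_integral_rnDeriv_add_singularPart θ ν
    (integrable_exp_mul_of_bounded θ hg hC β)
  have hsing : 0 ≤ ∫ x, Real.exp (β * g x) ∂(θ.singularPart ν) :=
    integral_nonneg fun x => (Real.exp_pos _).le
  have hM : 0 < ∫ x, f x * Real.exp (β * g x) ∂ν := by
    have h0 : 0 ≤ fun x => f x * Real.exp (β * g x) :=
      fun x => mul_nonneg ENNReal.toReal_nonneg (Real.exp_pos _).le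
    refine lt_of_le_of_ne (integral_nonneg h0) fun hz => hne ?_
    filter_upwards [(integral_eq_zero_iff_of_nonneg h0 hfi).mp hz.symm] with x hx
    exact (mul_eq_zero.mp hx).resolve_right (Real.exp_pos _).ne'
  have hW : 0 < ∫ x, w x ∂ν := integral_exp_pos (integrable_exp_mul_of_bounded ν hg hC γ)
  obtain ⟨hJ, hJeq⟩ := jensen_rpow_log (w := w) (h := h) (ν := ν) hα0 hα1'
    (fun x => Real.exp_pos _)
    (Filter.Eventually.of_forall fun x => mul_nonneg ENNReal.toReal_nonneg (Real.exp_pos _).le)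
    (fun hα => by
      filter_upwards [ae_toReal_rnDeriv_pos (hνθ hα)] with x hx
      exact mul_pos hx (Real.exp_pos _))
    (integrable_exp_mul_of_bounded ν hg hC γ) (by rw [hwh]; exact hfi) (by rw [hwp]; exact hint)
    hW (by rw [hwh]; exact hM) (by rw [hwp]; exact hB)
  rw [hwh, hwp, hα1] at hJ hJeq
  have hAM : β⁻¹ * Real.log (∫ x, Real.exp (β * g x) ∂θ)
        ≤ β⁻¹ * Real.log (∫ x, f x * Real.exp (β * g x) ∂ν) ∧
      (β⁻¹ * Real.log (∫ x, Real.exp (β * g x) ∂θ)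
        = β⁻¹ * Real.log (∫ x, f x * Real.exp (β * g x) ∂ν) → θ ≪ ν) := by
    rcases lt_or_gt_of_ne hβ with hβ' | hβ'
    · refine ⟨mul_le_mul_of_nonpos_left (Real.log_le_log hM ?_) (inv_nonpos.mpr hβ'.le),
        fun heq => ?_⟩
      · rw [hA]
        exact le_add_of_nonneg_right hsing
      · have hApos : 0 < ∫ x, Real.exp (β * g x) ∂θ := hA ▸ add_pos_of_pos_of_nonneg hM hsing
        have hlog := Real.log_injOn_pos hApos hM (mul_left_cancel₀ (inv_ne_zero hβ) heq)
        have hs0 : ∫ x, Real.exp (β * g x) ∂(θ.singularPart ν) = 0 := by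
          simp only [f] at hlog
          linarith
        rw [← Measure.singularPart_eq_zero]
        by_contra hs
        have : NeZero (θ.singularPart ν) := ⟨hs⟩
        exact (integral_exp_pos (integrable_exp_mul_of_bounded (θ.singularPart ν) hg hC β)).ne' hs0
    · have hac : θ ≪ ν := hθν ((one_lt_div hk).mpr (by linarith))
      refine ⟨le_of_eq ?_, fun _ => hac⟩
      rw [hA, Measure.singularPart_eq_zero_of_ac hac, integral_zero_measure, add_zero]
  set A := ∫ x, Real.exp (β * g x) ∂θ
  set M := ∫ x, f x * Real.exp (β * g x) ∂ν
  set B := ∫ x, f x ^ (γ / (γ - β)) ∂ν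
  set W := ∫ x, w x ∂ν
  have hV : V = γ⁻¹ * Real.log W - (β⁻¹ * Real.log M - β⁻¹ * Real.log A)
      - (γ - β)⁻¹ * ((γ / (γ - β) * (β / (γ - β)))⁻¹ *
        (Real.log B - γ / (γ - β) * Real.log M + β / (γ - β) * Real.log W)) := by
    simp only [V, hα1]
    change β⁻¹ * Real.log A - (γ - β)⁻¹ * ((γ / (γ - β) * (β / (γ - β)))⁻¹ * Real.log B) = _
    have := hk.ne'
    field_simp
    ring
  have hJ' := mul_nonneg (inv_nonneg.mpr hk.le) hJ
  refine ⟨?_, fun heq => ⟨hAM.2 ?_, M / W, ?_⟩⟩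
  · rw [hV]
    linarith [hAM.1]
  · rw [hV] at heq
    change _ = γ⁻¹ * Real.log W at heq
    linarith [hAM.1]
  · rw [hV] at heq
    change _ = γ⁻¹ * Real.log W at heq
    have hz : (γ - β)⁻¹ * ((γ / (γ - β) * (β / (γ - β)))⁻¹ *
        (Real.log B - γ / (γ - β) * Real.log M + β / (γ - β) * Real.log W)) = 0 := by
      linarith [hAM.1]
    have hL := (mul_eq_zero.mp ((mul_eq_zero.mp hz).resolve_left
      (inv_ne_zero hk.ne'))).resolve_left
      (inv_ne_zero (mul_ne_zero hα0 (div_ne_zero hβ hk.ne')))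
    filter_upwards [hJeq hL] with x hx
    rw [← hx]
    simp only [h, f]
    rw [mul_assoc, ← Real.exp_add, neg_add_cancel, Real.exp_zero, mul_one]

/-- The tilted measure attains the upper bound in the Rényi variational formula. -/
lemma renyi_functional_tilted {S : Type*} [MeasurableSpace S]
    (ν : Measure S) [IsProbabilityMeasure ν]
    {β γ : ℝ} (hβ : β ≠ 0) (hγ : γ ≠ 0) (hβγ : β < γ)
    {g : S → ℝ} (hg : Measurable g) {C : ℝ} (hC : ∀ x, |g x| ≤ C)
    {Z : ℝ} (hZ : 0 < Z) {θ : Measure S} [IsFiniteMeasure θ]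
    (hθ : θ = ν.withDensity fun x => ENNReal.ofReal (Real.exp ((γ - β) * g x) / Z)) :
    ((β⁻¹ * Real.log (∫ x, Real.exp (β * g x) ∂θ) : ℝ) : EReal)
        - (((γ - β)⁻¹ : ℝ) : EReal) * renyiDiv (γ / (γ - β)) θ ν
      = ((γ⁻¹ * Real.log (∫ x, Real.exp (γ * g x) ∂ν) : ℝ) : EReal) := by
  have hk : 0 < γ - β := sub_pos.mpr hβγ
  have hα0 : γ / (γ - β) ≠ 0 := div_ne_zero hγ hk.ne'
  have hα1 : γ / (γ - β) - 1 = β / (γ - β) := by field_simp; ring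
  have hW : 0 < ∫ x, Real.exp (γ * g x) ∂ν :=
    integral_exp_pos (integrable_exp_mul_of_bounded ν hg hC γ)
  have hd : Measurable fun x => ENNReal.ofReal (Real.exp ((γ - β) * g x) / Z) := by fun_prop
  have hθν : θ ≪ ν := hθ ▸ withDensity_absolutelyContinuous _ _
  have hνθ : ν ≪ θ := hθ ▸ withDensity_absolutelyContinuous' hd.aemeasurable
    (Filter.Eventually.of_forall fun x => by
      simpa using div_pos (Real.exp_pos _) hZ)
  have hA : ∫ x, Real.exp (β * g x) ∂θ = (∫ x, Real.exp (γ * g x) ∂ν) / Z := by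
    rw [hθ, integral_withDensity_eq_integral_toReal_smul hd
      (Filter.Eventually.of_forall fun x => ENNReal.ofReal_lt_top), ← integral_div]
    congr 1
    funext x
    rw [ENNReal.toReal_ofReal (div_pos (Real.exp_pos _) hZ).le, smul_eq_mul, div_mul_eq_mul_div,
      ← Real.exp_add]
    ring_nf
  have hB : ∫⁻ x, θ.rnDeriv ν x ^ (γ / (γ - β)) ∂ν =
      ENNReal.ofReal ((∫ x, Real.exp (γ * g x) ∂ν) / Z ^ (γ / (γ - β))) := by
    rw [← integral_div, ofReal_integral_eq_lintegral_ofReal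
      ((integrable_exp_mul_of_bounded ν hg hC γ).div_const _)
      (Filter.Eventually.of_forall fun x =>
        div_nonneg (Real.exp_pos _).le (Real.rpow_nonneg hZ.le _))]
    refine lintegral_congr_ae ?_
    filter_upwards [hθ ▸ Measure.rnDeriv_withDensity ν hd] with x hx
    rw [hx, ENNReal.ofReal_rpow_of_pos (div_pos (Real.exp_pos _) hZ),
      Real.div_rpow (Real.exp_pos _).le hZ.le, ← Real.exp_mul]
    congr 3
    field_simp
  have hZα : 0 < Z ^ (γ / (γ - β)) := Real.rpow_pos_of_pos hZ _
  rw [renyiDiv_eq_ite hα0, if_neg (by simp [hθν, hνθ]), hB, hA,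
    ENNReal.log_ofReal_of_pos (div_pos hW hZα), ← EReal.coe_mul, ← EReal.coe_mul,
    ← EReal.coe_sub, EReal.coe_eq_coe_iff, Real.log_div hW.ne' hZ.ne',
    Real.log_div hW.ne' hZα.ne', Real.log_rpow hZ, hα1]
  have := hk.ne'
  field_simp
  ring

/-- **Attainment and uniqueness of the maximizer in the Rényi variational formula.**
The supremum of `θ ↦ (1/β) log ∫ e^{βg} dθ - (1/(γ-β)) R_{γ/(γ-β)}(θ‖ν)` over probability
measures is uniquely attained at `dθ* = e^{(γ-β)g} dν / Z`, `Z = ∫ e^{(γ-β)g} dν`. -/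
theorem renyi_sup_attained_uniquely {S : Type*} [MeasurableSpace S]
    (ν : Measure S) [IsProbabilityMeasure ν]
    (β γ : ℝ) (hβ : β ≠ 0) (hγ : γ ≠ 0) (hβγ : β < γ)
    (g : S → ℝ) (hg : Measurable g) (hgbd : ∃ C : ℝ, ∀ x, |g x| ≤ C)
    (Z : ℝ) (hZ : Z = ∫ x, Real.exp ((γ - β) * g x) ∂ν)
    (θstar : Measure S)
    (hθstar : θstar = ν.withDensity fun x => ENNReal.ofReal (Real.exp ((γ - β) * g x) / Z))
    (F : Measure S → EReal)
    (hF : F = fun θ : Measure S =>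
      ((β⁻¹ * Real.log (∫ x, Real.exp (β * g x) ∂θ) : ℝ) : EReal)
        - (((γ - β)⁻¹ : ℝ) : EReal) * renyiDiv (γ / (γ - β)) θ ν) :
    IsProbabilityMeasure θstar ∧
      F θstar = (⨆ (θ : Measure S) (_ : IsProbabilityMeasure θ), F θ) ∧
      ∀ θ : Measure S, IsProbabilityMeasure θ → F θ = F θstar → θ = θstar := by
  obtain ⟨C, hC⟩ := hgbd
  have hk : 0 < γ - β := sub_pos.mpr hβγ
  have hα0 : γ / (γ - β) ≠ 0 := div_ne_zero hγ hk.ne'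
  have hα1 : γ / (γ - β) ≠ 1 := by
    rw [ne_eq, div_eq_one_iff_eq hk.ne']
    intro h
    exact hβ (by linarith)
  have hZi := integrable_exp_mul_of_bounded ν hg hC (γ - β)
  have hZpos : 0 < Z := hZ ▸ integral_exp_pos hZi
  have hprob : IsProbabilityMeasure θstar := by
    constructor
    rw [hθstar, withDensity_apply _ MeasurableSet.univ, Measure.restrict_univ,
      ← ofReal_integral_eq_lintegral_ofReal (hZi.div_const Z)
        (Filter.Eventually.of_forall fun x => (div_pos (Real.exp_pos _) hZpos).le),
      integral_div, ← hZ, div_self hZpos.ne', ENNReal.ofReal_one]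
  have hstar : F θstar = ((γ⁻¹ * Real.log (∫ x, Real.exp (γ * g x) ∂ν) : ℝ) : EReal) := by
    rw [hF]
    exact renyi_functional_tilted ν hβ hγ hβγ hg hC hZpos hθstar
  have key : ∀ θ : Measure S, IsProbabilityMeasure θ →
      F θ ≤ F θstar ∧ (F θ = F θstar → θ = θstar) := by
    intro θ hθ
    rw [hstar, hF]
    rcases renyiDiv_eq_top_or hα0 hα1 θ ν with htop | ⟨hθν, hνθ, hint, hne, hB, hval⟩
    · have hbot : ((β⁻¹ * Real.log (∫ x, Real.exp (β * g x) ∂θ) : ℝ) : EReal)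
          - (((γ - β)⁻¹ : ℝ) : EReal) * renyiDiv (γ / (γ - β)) θ ν = ⊥ := by
        rw [htop, EReal.coe_mul_top_of_pos (inv_pos.mpr hk), EReal.sub_top]
      simp only [hbot]
      exact ⟨bot_le, fun h => absurd h.symm (EReal.coe_ne_bot _)⟩
    · obtain ⟨hle, heq⟩ := renyi_functional_le ν θ hβ hγ hβγ hg hC hθν hνθ hint hne hB
      simp only [hval, ← EReal.coe_mul, ← EReal.coe_sub, EReal.coe_le_coe_iff,
        EReal.coe_eq_coe_iff]
      refine ⟨hle, fun h => ?_⟩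
      obtain ⟨hac, c, hc⟩ := heq h
      have hcZ : c = Z⁻¹ := by
        have h1 := Measure.integral_toReal_rnDeriv hac
        rw [integral_congr_ae hc, integral_const_mul, ← hZ, probReal_univ] at h1
        exact eq_inv_of_mul_eq_one_left h1
      rw [hθstar, ← Measure.withDensity_rnDeriv_eq θ ν hac]
      refine withDensity_congr_ae ?_
      filter_upwards [hc, θ.rnDeriv_lt_top ν] with x hx hx'
      rw [← ENNReal.ofReal_toReal hx'.ne, hx, hcZ, inv_mul_eq_div]
  refine ⟨hprob, le_antisymm (le_iSup₂_of_le θstar hprob le_rfl) ?_, fun θ hθ => (key θ hθ).2⟩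
  exact iSup₂_le fun θ hθ => (key θ hθ).1
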